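/- arXiv:1005.4959 — 2 statements merged into one kernel-verified Lean document; each statement's English description precedes it below -/
import Mathlib

section
/- For all positive integers n, d and every integer k ≥ 2, A_k(n+1,d) ≤ 2·A_k(n,d), where A_k(n+1,d) and A_k(n,d) are the semidefinite programming bounds for word lengths n+1 and n respectively. -/
open scoped Classical

noncomputable section

/-- `S` is a code of minimum distance at least `d`. -/
def IsCode (n d : ℕ) (S : Finset (Fin n → Bool)) : Prop :=
  ∀ u ∈ S, ∀ v ∈ S, u ≠ v → d ≤ hammingDist u v

/-- The collection `𝒩_k` of codes of minimum distance at least `d` and size at most `k`. -/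
def NNk (n d k : ℕ) : Set (Finset (Fin n → Bool)) :=
  {S | IsCode n d S ∧ S.card ≤ k}

/-- The index set `𝒩(S)` of the matrix `M_S(x)`. -/
abbrev NSet (n d k : ℕ) (S : Finset (Fin n → Bool)) :=
  {S' : Finset (Fin n → Bool) //
    IsCode n d S' ∧ S ⊆ S' ∧ S.card + 2 * (S' \ S).card ≤ k}

/-- The matrix `M_S(x)`. -/
def MS (n d k : ℕ) (S : Finset (Fin n → Bool)) (x : Finset (Fin n → Bool) → ℝ) :
    Matrix (NSet n d k S) (NSet n d k S) ℝ :=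
  fun S' S'' => if IsCode n d (S'.1 ∪ S''.1) then x (S'.1 ∪ S''.1) else 0

/-- Feasibility for the semidefinite program defining `A_k(n,d)`. -/
def Feasible (n d k : ℕ) (x : Finset (Fin n → Bool) → ℝ) : Prop :=
  x ∅ = 1 ∧ ∀ S ∈ NNk n d k, (MS n d k S x).PosSemidef

/-- The objective value `∑_{v ∈ N} x({v})`. -/
def Obj (n : ℕ) (x : Finset (Fin n → Bool) → ℝ) : ℝ :=
  ∑ v : Fin n → Bool, x {v}

/-- The semidefinite programming bound `A_k(n,d)`. -/
def Abound (n d k : ℕ) : ℝ :=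
  sSup {y : ℝ | ∃ x : Finset (Fin n → Bool) → ℝ, Feasible n d k x ∧ y = Obj n x}

/-- The code obtained from `S` by putting the letter `b` in front of every word. -/
def consCode {n : ℕ} (b : Bool) (S : Finset (Fin n → Bool)) : Finset (Fin (n + 1) → Bool) :=
  S.map ⟨Fin.cons b, Fin.cons_right_injective (α := fun _ => Bool) b⟩

lemma hammingDist_cons {n : ℕ} (b : Bool) (u v : Fin n → Bool) :
    hammingDist (Fin.cons b u : Fin (n + 1) → Bool) (Fin.cons b v : Fin (n + 1) → Bool) =
      hammingDist u v := by
  simp [hammingDist, Finset.card_filter, Fin.sum_univ_succ]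

lemma isCode_consCode {n d : ℕ} (b : Bool) (S : Finset (Fin n → Bool)) :
    IsCode (n + 1) d (consCode b S) ↔ IsCode n d S := by
  simp [IsCode, consCode, hammingDist_cons]

lemma consCode_union {n : ℕ} (b : Bool) (S T : Finset (Fin n → Bool)) :
    consCode b (S ∪ T) = consCode b S ∪ consCode b T :=
  Finset.map_union _ _

lemma card_consCode {n : ℕ} (b : Bool) (S : Finset (Fin n → Bool)) :
    (consCode b S).card = S.card :=
  Finset.card_map _

lemma consCode_sdiff {n : ℕ} (b : Bool) (S T : Finset (Fin n → Bool)) :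
    consCode b (S \ T) = consCode b S \ consCode b T := by
  simp only [consCode, Finset.map_eq_image]
  exact Finset.image_sdiff _ _ (Function.Embedding.injective _)

lemma consCode_subset {n : ℕ} (b : Bool) {S T : Finset (Fin n → Bool)} (h : S ⊆ T) :
    consCode b S ⊆ consCode b T :=
  Finset.map_subset_map.2 h

lemma Feasible.comp_consCode {n d k : ℕ} {x : Finset (Fin (n + 1) → Bool) → ℝ}
    (hx : Feasible (n + 1) d k x) (b : Bool) :
    Feasible n d k (fun S => x (consCode b S)) := by
  refine ⟨by simpa [consCode] using hx.1, fun S hS => ?_⟩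
  have hpsd := hx.2 (consCode b S)
    ⟨(isCode_consCode b S).2 hS.1, (card_consCode b S).trans_le hS.2⟩
  let f : NSet n d k S → NSet (n + 1) d k (consCode b S) := fun T =>
    ⟨consCode b T.1, (isCode_consCode b T.1).2 T.2.1, consCode_subset b T.2.2.1, by
      rw [← consCode_sdiff, card_consCode, card_consCode]
      exact T.2.2.2⟩
  convert hpsd.submatrix f using 1
  ext T U
  simp only [MS, Matrix.submatrix_apply, f, ← consCode_union, isCode_consCode]

lemma Obj_succ (n : ℕ) (x : Finset (Fin (n + 1) → Bool) → ℝ) :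
    Obj (n + 1) x =
      Obj n (fun S => x (consCode true S)) + Obj n (fun S => x (consCode false S)) := by
  unfold Obj
  rw [← (Fin.consEquiv fun _ => Bool).sum_comp, Fintype.sum_prod_type, Fintype.sum_bool]
  simp [consCode, Fin.consEquiv]

lemma Feasible.singleton_mem_Icc {n d k : ℕ} (hk : 2 ≤ k) {x : Finset (Fin n → Bool) → ℝ}
    (hx : Feasible n d k x) (v : Fin n → Bool) : x {v} ∈ Set.Icc 0 1 := by
  have hpsd := hx.2 ∅ ⟨by simp [IsCode], by simp⟩
  let e : NSet n d k ∅ := ⟨∅, by simp [IsCode]⟩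
  let s : NSet n d k ∅ := ⟨{v}, by simpa [IsCode] using hk⟩
  have hdet := (hpsd.submatrix ![e, s]).det_nonneg
  have hdiag : 0 ≤ MS n d k ∅ x s s := hpsd.diag_nonneg
  simp [Matrix.det_fin_two, MS, e, s, IsCode, hx.1] at hdet hdiag
  exact ⟨hdiag, by nlinarith⟩

lemma Feasible.Obj_nonneg {n d k : ℕ} (hk : 2 ≤ k) {x : Finset (Fin n → Bool) → ℝ}
    (hx : Feasible n d k x) : 0 ≤ Obj n x :=
  Finset.sum_nonneg fun v _ => (hx.singleton_mem_Icc hk v).1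

lemma Feasible.Obj_le_Abound {n d k : ℕ} (hk : 2 ≤ k) {x : Finset (Fin n → Bool) → ℝ}
    (hx : Feasible n d k x) : Obj n x ≤ Abound n d k := by
  refine le_csSup ⟨∑ _v : Fin n → Bool, 1, ?_⟩ ⟨x, hx, rfl⟩
  rintro _ ⟨y, hy, rfl⟩
  exact Finset.sum_le_sum fun v _ => (hy.singleton_mem_Icc hk v).2

/-- `A_k(n+1,d) ≤ 2 · A_k(n,d)`. -/
theorem Abound_succ_le_two_mul (n d k : ℕ) (hn : 0 < n) (hd : 0 < d) (hk : 2 ≤ k) :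
    Abound (n + 1) d k ≤ 2 * Abound n d k := by
  have hnonneg : 0 ≤ Abound n d k :=
    Real.sSup_nonneg fun _ ⟨_, hx, h⟩ => h ▸ hx.Obj_nonneg hk
  refine Real.sSup_le ?_ (by positivity)
  rintro _ ⟨x, hx, rfl⟩
  rw [Obj_succ, two_mul]
  exact add_le_add ((hx.comp_consCode true).Obj_le_Abound hk)
    ((hx.comp_consCode false).Obj_le_Abound hk)
end
end

section
/- For every positive integer n, every λ ∈ Λ_T^n, and every integer m with 0 ≤ m ≤ n, the following matrix identity holds: (U_0^{⊗m} ⊗ U_1^{⊗(n−m)})^* · B_λ · (U_0^{⊗m} ⊗ U_1^{⊗(n−m)}) = ∑_{α ∈ Λ_P^m, β ∈ Λ_P^{n−m}} ϑ_{λ,α,β} · (M_α ⊗ M_β), where the sum effectively runs over pairs (α,β) with α + β = λ'. -/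
open scoped Classical
open Matrix

noncomputable section

/-- `P = {0,1}²` with coordinatewise addition mod 2. -/
abbrev Pt := ZMod 2 × ZMod 2

/-- `T = {0,1}³` with coordinatewise addition mod 2. -/
abbrev Tt := ZMod 2 × ZMod 2 × ZMod 2

/-- The fiber-count map: `count ρ v = |ρ⁻¹(v)|`. -/
def count {V : Type*} [DecidableEq V] {m : ℕ} (ρ : Fin m → V) : V → ℕ :=
  fun v => (Finset.univ.filter fun i => ρ i = v).card

/-- `Λ_V^m`: the functions `λ : V → ℕ` with `∑_{v∈V} λ(v) = m`. -/
def Lambda (V : Type*) [Fintype V] (m : ℕ) : Type _ :=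
  {α : V → ℕ // ∑ v, α v = m}

instance (V : Type*) [Fintype V] (m : ℕ) : Fintype (Lambda V m) :=
  Fintype.ofInjective
    (fun α : Lambda V m => fun v : V =>
      (⟨α.1 v, by
        have h1 : α.1 v ≤ ∑ w, α.1 w :=
          Finset.single_le_sum (f := α.1) (fun _ _ => Nat.zero_le _) (Finset.mem_univ v)
        have h2 := α.2
        omega⟩ : Fin (m + 1)))
    (by
      intro α β h
      apply Subtype.ext
      funext v
      exact congrArg Fin.val (congrFun h v))

/-- For `c ∈ P`, the `2×2` matrix `E_c` with a single `1` in position `(c₁, c₂)`. -/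
def Emat (c : Pt) : Matrix (ZMod 2) (ZMod 2) ℂ :=
  fun a b => if a = c.1 ∧ b = c.2 then 1 else 0

/-- For `t ∈ T`, the `P×P` matrix `B_t = E_{c,d} + E_{c̄,d̄}`, i.e. the `0,1` matrix
whose support consists of the two pairs `(c,d)` with
`c₁+c₂ = t₁`, `d₁+d₂ = t₂`, `c₂+d₂ = t₃` (mod 2). -/
def Bmat (t : Tt) : Matrix Pt Pt ℂ :=
  fun c d =>
    if c.1 + c.2 = t.1 ∧ d.1 + d.2 = t.2.1 ∧ c.2 + d.2 = t.2.2 then 1 else 0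

/-- `M_α = ∑_{ρ ∈ Ω_α} ⊗_{i=1}^m E_{ρ(i)}`, realized as a matrix with rows and
columns indexed by `{0,1}^m` (the `(u,v)` entry of `⊗ᵢ E_{ρ(i)}` is `∏ᵢ (E_{ρ(i)})_{uᵢ,vᵢ}`). -/
def Mmat {m : ℕ} (α : Lambda Pt m) : Matrix (Fin m → ZMod 2) (Fin m → ZMod 2) ℂ :=
  fun u v => ∑ ρ : Fin m → Pt,
    if count ρ = α.1 then ∏ i, Emat (ρ i) (u i) (v i) else 0

/-- `B_λ = ∑_{ρ ∈ Ω_λ} ⊗_{i=1}^n B_{ρ(i)}`, realized as a matrix with rows and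
columns indexed by `P^n`. -/
def BmatN {n : ℕ} (lam : Lambda Tt n) : Matrix (Fin n → Pt) (Fin n → Pt) ℂ :=
  fun u v => ∑ ρ : Fin n → Tt,
    if count ρ = lam.1 then ∏ i, Bmat (ρ i) (u i) (v i) else 0

/-- The `P×{0,1}` matrices `U_i`, `(U_i)_{c,a} = (1/√2)·(−1)^{i c₂}·δ_{a, c₁+c₂}`. -/
def Umat (i : Fin 2) : Matrix Pt (ZMod 2) ℂ :=
  fun c a =>
    (((Real.sqrt 2)⁻¹ : ℝ) : ℂ) * (-1 : ℂ) ^ ((i : ℕ) * (c.2.val)) *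
      (if a = c.1 + c.2 then 1 else 0)

/-- The tensor product `U_0^{⊗m} ⊗ U_1^{⊗(n−m)}`, realized as a matrix from `P^n`
to `{0,1}^n` (factor `U_0` in the first `m` coordinates, `U_1` in the rest). -/
def UU (n m : ℕ) : Matrix (Fin n → Pt) (Fin n → ZMod 2) ℂ :=
  fun ρ a => ∏ i : Fin n, (if (i : ℕ) < m then Umat 0 else Umat 1) (ρ i) (a i)

/-- The Krawtchouk polynomial `K_k^n(t) = ∑_{i=0}^k (−1)^i C(t,i) C(n−t, k−i)`. -/
def Kraw (n k t : ℕ) : ℤ :=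
  ∑ i ∈ Finset.range (k + 1),
    (-1 : ℤ) ^ i * (t.choose i) * ((n - t).choose (k - i))

/-- `λ' ∈ Λ_P^n` defined from `λ ∈ Λ_T^n` by `λ'(c) = λ(c0) + λ(c1)`. -/
def lamPrime {n : ℕ} (lam : Lambda Tt n) : Pt → ℕ :=
  fun c => lam.1 (c.1, c.2, 0) + lam.1 (c.1, c.2, 1)

/-- `ϑ_{λ,α,β} = δ_{λ', α+β} · ∏_{c∈P} K_{λ(c1)}^{λ'(c)}(β(c))`. -/
def theta {n m : ℕ} (lam : Lambda Tt n) (α : Lambda Pt m) (β : Lambda Pt (n - m)) : ℤ :=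
  if lamPrime lam = fun c => α.1 c + β.1 c then
    ∏ c : Pt, Kraw (lamPrime lam c) (lam.1 (c.1, c.2, 1)) (β.1 c)
  else 0

/-- The tensor (Kronecker) product `A ⊗ B` of a `{0,1}^m`-indexed matrix and a
`{0,1}^{n−m}`-indexed matrix, realized as a `{0,1}^n`-indexed matrix via splitting
the coordinates at `m`. -/
def kron {n m : ℕ} (h : m ≤ n)
    (A : Matrix (Fin m → ZMod 2) (Fin m → ZMod 2) ℂ)
    (B : Matrix (Fin (n - m) → ZMod 2) (Fin (n - m) → ZMod 2) ℂ) :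
    Matrix (Fin n → ZMod 2) (Fin n → ZMod 2) ℂ :=
  fun u v =>
    A (fun i => u (Fin.castLE h i)) (fun i => v (Fin.castLE h i)) *
      B (fun j => u ⟨m + j.1, by have := j.isLt; omega⟩)
        (fun j => v ⟨m + j.1, by have := j.isLt; omega⟩)

open Polynomial in
/-- The generating function of the Krawtchouk polynomials. -/
theorem coeff_eq_Kraw (n k t : ℕ) :
    ((1 + -X : ℤ[X]) ^ t * (1 + X) ^ (n - t)).coeff k = Kraw n k t := by
  have key (j : ℕ) : ((1 + -X : ℤ[X]) ^ t).coeff j = (-1) ^ j * (t.choose j) := by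
    have : (1 + -X : ℤ[X]) ^ t = ((1 + X) ^ t).comp (C (-1) * X) := by simp
    rw [this, comp_C_mul_X_coeff, coeff_one_add_X_pow, mul_comm]
  rw [coeff_mul, Finset.Nat.sum_antidiagonal_eq_sum_range_succ_mk, Kraw]
  exact Finset.sum_congr rfl fun j _ => by rw [key, coeff_one_add_X_pow]

theorem sum_zmod_two {M : Type*} [AddCommMonoid M] (f : ZMod 2 → M) :
    ∑ z, f z = f 0 + f 1 :=
  Fin.sum_univ_two f

theorem sum_val_eq_card {I : Type*} [Fintype I] (τ : I → ZMod 2) :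
    ∑ i, (τ i).val = (Finset.univ.filter fun i => τ i = 1).card := by
  rw [Finset.card_filter]
  refine Finset.sum_congr rfl fun i _ => ?_
  generalize τ i = z
  revert z
  decide

/-- The signed count of the 0-1 words of weight `k` is a value of a Krawtchouk polynomial. -/
theorem sum_sign_eq_Kraw {I : Type*} [Fintype I] [DecidableEq I] (s : I → Prop) (k : ℕ) :
    (∑ τ : I → ZMod 2, if (Finset.univ.filter fun i => τ i = 1).card = k then
        ∏ i, (if s i then -1 else 1 : ℤ) ^ (τ i).val else 0) =
      Kraw (Fintype.card I) k (Finset.univ.filter fun i => s i).card := by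
  open Polynomial in
  have key : ∏ i, ∑ z : ZMod 2, (C (if s i then -1 else 1 : ℤ) * X) ^ z.val =
      (1 + -X : ℤ[X]) ^ (Finset.univ.filter fun i => s i).card *
        (1 + X) ^ (Fintype.card I - (Finset.univ.filter fun i => s i).card) := by
    have hz (i : I) : ∑ z : ZMod 2, (C (if s i then -1 else 1 : ℤ) * X) ^ z.val =
        if s i then (1 + -X : ℤ[X]) else 1 + X := by
      rw [sum_zmod_two]
      split_ifs <;> simp [ZMod.val_one]
    simp_rw [hz]
    rw [Finset.prod_ite, Finset.prod_const, Finset.prod_const, ← Finset.card_univ,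
      ← Finset.card_filter_add_card_filter_not (s := (Finset.univ : Finset I)) s,
      Nat.add_sub_cancel_left]
  rw [← coeff_eq_Kraw, ← key, Fintype.prod_sum, Polynomial.finsetSum_coeff]
  refine Finset.sum_congr rfl fun τ _ => ?_
  simp_rw [mul_pow]
  rw [Finset.prod_mul_distrib, Finset.prod_pow_eq_pow_sum, sum_val_eq_card]
  simp_rw [← Polynomial.C_pow]
  rw [← map_prod, Polynomial.coeff_C_mul_X_pow]
  simp only [eq_comm]

/-- Words on `I` are families of words on the fibers of `f : I → κ`. -/
def fiberWordEquiv {I κ : Type*} (f : I → κ) (A : Type*) :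
    (I → A) ≃ ∀ c, {i // f i = c} → A :=
  ((Equiv.sigmaFiberEquiv f).arrowCongr (Equiv.refl A)).symm.trans
    (Equiv.piCurry fun _ _ => A)

theorem card_filter_fiber {I κ : Type*} [Fintype I] [DecidableEq κ] (f : I → κ) (c : κ)
    (p : I → Prop) [DecidablePred p] :
    (Finset.univ.filter fun i : {i // f i = c} => p i).card =
      (Finset.univ.filter fun i => f i = c ∧ p i).card := by
  rw [← Finset.card_map (Function.Embedding.subtype _)]
  congr 1
  ext i
  simp [and_comm]

/-- The signed count of the 0-1 words with prescribed weights on the fibers of `f`. -/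
theorem sum_sign_eq_prod_Kraw {I κ : Type*} [Fintype I] [DecidableEq I] [Fintype κ] [DecidableEq κ]
    (f : I → κ) (s : I → Prop) (k : κ → ℕ) :
    (∑ τ : I → ZMod 2,
        if ∀ c, (Finset.univ.filter fun i => f i = c ∧ τ i = 1).card = k c then
          ∏ i, (if s i then -1 else 1 : ℤ) ^ (τ i).val else 0) =
      ∏ c, Kraw (Finset.univ.filter fun i => f i = c).card (k c)
        (Finset.univ.filter fun i => f i = c ∧ s i).card := by
  have hc (c : κ) := sum_sign_eq_Kraw (fun i : {i // f i = c} => s i) (k c)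
  simp_rw [card_filter_fiber f _ s, Fintype.card_subtype] at hc
  simp_rw [← hc]
  have hprod := Fintype.prod_sum (κ := fun c => {i // f i = c} → ZMod 2)
    fun c (τ : {i // f i = c} → ZMod 2) =>
      if (Finset.univ.filter fun i => τ i = 1).card = k c then
        ∏ i : {i // f i = c}, (if s i then -1 else 1 : ℤ) ^ (τ i).val else 0
  refine Eq.trans ?_ hprod.symm
  refine Fintype.sum_equiv (fiberWordEquiv f _) _ _ fun τ => ?_
  have hv (c : κ) (i : {i // f i = c}) : fiberWordEquiv f _ τ c i = τ i := rfl
  simp_rw [hv, card_filter_fiber f _ (fun i => τ i = 1), Finset.prod_ite_zero, Finset.mem_univ,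
    true_imp_iff]
  refine if_congr Iff.rfl ?_ rfl
  exact (Fintype.prod_fiberwise f fun i => (if s i then -1 else 1 : ℤ) ^ (τ i).val).symm

/-- The conjugate of `B_t` by `U_i`, entrywise. -/
theorem conj_Bmat_apply (i : Fin 2) (t : Tt) (a b : ZMod 2) :
    ∑ d, ∑ c, star (Umat i c a) * Bmat t c d * Umat i d b =
      if t.1 = a ∧ t.2.1 = b then (-1 : ℂ) ^ ((i : ℕ) * t.2.2.val) else 0 := by
  have hr : (((√2)⁻¹ : ℝ) : ℂ) * (((√2)⁻¹ : ℝ) : ℂ) = 2⁻¹ := by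
    rw [← Complex.ofReal_mul, ← mul_inv, Real.mul_self_sqrt zero_le_two]
    simp
  have h2 : (1 : ZMod 2) + 1 = 0 := rfl
  have h2' (z : ZMod 2) : z = 0 ∨ z = 1 := by decide +revert
  simp only [Fintype.sum_prod_type, sum_zmod_two, Umat, Bmat, star_mul']
  obtain ⟨x, y, z⟩ := t
  have hs : star (((√2)⁻¹ : ℝ) : ℂ) = (((√2)⁻¹ : ℝ) : ℂ) := Complex.conj_ofReal _
  generalize (((√2)⁻¹ : ℝ) : ℂ) = r at hr hs
  fin_cases i <;>
  rcases h2' x with rfl | rfl <;> rcases h2' y with rfl | rfl <;> rcases h2' z with rfl | rfl <;>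
  rcases h2' a with rfl | rfl <;> rcases h2' b with rfl | rfl <;>
  simp [h2, ZMod.val_one, hs] <;>
  first
    | linear_combination 2 * hr
    | linear_combination -2 * hr

theorem conj_BmatN_apply {n : ℕ} (lam : Lambda Tt n) (m : ℕ) (a b : Fin n → ZMod 2) :
    ((UU n m)ᴴ * BmatN lam * UU n m) a b =
      ∑ ρ : Fin n → Tt, if count ρ = lam.1 then
        ∏ i : Fin n, (if (ρ i).1 = a i ∧ (ρ i).2.1 = b i then
          (if ¬ (i : ℕ) < m then -1 else 1 : ℂ) ^ (ρ i).2.2.val else 0) else 0 := by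
  have hsite (i : Fin n) (t : Tt) :
      (if t.1 = a i ∧ t.2.1 = b i then
          (if ¬ (i : ℕ) < m then -1 else 1 : ℂ) ^ t.2.2.val else 0) =
      ∑ d, ∑ c, star ((if (i : ℕ) < m then Umat 0 else Umat 1) c (a i)) * Bmat t c d *
        (if (i : ℕ) < m then Umat 0 else Umat 1) d (b i) := by
    by_cases hi : (i : ℕ) < m
    · simp only [hi, if_true, conj_Bmat_apply]
      simp
    · simp only [hi, if_false, conj_Bmat_apply]
      simp
  simp_rw [hsite, Fintype.prod_sum]
  simp only [Matrix.mul_apply, Matrix.conjTranspose_apply, UU, BmatN, Finset.mul_sum,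
    Finset.sum_mul]
  rw [Finset.sum_congr rfl fun d _ => Finset.sum_comm, Finset.sum_comm]
  refine Finset.sum_congr rfl fun ρ _ => ?_
  split_ifs
  · refine Finset.sum_congr rfl fun d _ => Finset.sum_congr rfl fun c _ => ?_
    simp only [star_prod, Finset.prod_mul_distrib]
  · simp

theorem Mmat_apply {m : ℕ} (α : Lambda Pt m) (u v : Fin m → ZMod 2) :
    Mmat α u v = if count (fun i => (u i, v i)) = α.1 then 1 else 0 := by
  rw [Mmat, Finset.sum_eq_single fun i => (u i, v i)]
  · simp [Emat]
  · intro ρ _ hρ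
    obtain ⟨i, hi⟩ := Function.ne_iff.1 hρ
    split_ifs
    · refine Finset.prod_eq_zero (Finset.mem_univ i) (if_neg fun h => hi ?_)
      exact Prod.ext h.1.symm h.2.symm
    · rfl
  · simp

theorem sum_count {V : Type*} [Fintype V] [DecidableEq V] {m : ℕ} (ρ : Fin m → V) :
    ∑ v, count ρ v = m := by
  have := Finset.card_eq_sum_card_fiberwise (s := Finset.univ) (t := Finset.univ) (f := ρ)
    (by simp)
  simpa [count] using this.symm

theorem sum_sum_mul_ite_count {m k : ℕ} (ρ : Fin m → Pt) (σ : Fin k → Pt)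
    (g : Lambda Pt m → Lambda Pt k → ℂ) :
    ∑ α : Lambda Pt m, ∑ β : Lambda Pt k,
        g α β * ((if count ρ = α.1 then 1 else 0) * (if count σ = β.1 then 1 else 0)) =
      g ⟨count ρ, sum_count ρ⟩ ⟨count σ, sum_count σ⟩ := by
  refine (Finset.sum_eq_single ⟨count ρ, sum_count ρ⟩ ?_ ?_).trans
    ((Finset.sum_eq_single ⟨count σ, sum_count σ⟩ ?_ ?_).trans ?_)
  · intro α _ hα
    refine Finset.sum_eq_zero fun β _ => ?_
    rw [if_neg fun h => hα (Subtype.ext h.symm), zero_mul, mul_zero]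
  · exact fun h => (h (Finset.mem_univ _)).elim
  · intro β _ hβ
    rw [if_neg (show ¬ count σ = β.1 from fun h => hβ (Subtype.ext h.symm)), mul_zero, mul_zero]
  · exact fun h => (h (Finset.mem_univ _)).elim
  · simp

theorem count_castLE {n m : ℕ} (h : m ≤ n) (ρ : Fin n → Pt) (c : Pt) :
    count (fun i => ρ (Fin.castLE h i)) c =
      (Finset.univ.filter fun i : Fin n => ρ i = c ∧ (i : ℕ) < m).card := by
  rw [count, ← Finset.card_map (Fin.castLEEmb h)]
  congr 1
  ext i
  simp only [Finset.mem_map, Finset.mem_filter, Finset.mem_univ, true_and]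
  constructor
  · rintro ⟨j, hj, rfl⟩
    exact ⟨hj, j.isLt⟩
  · exact fun hi => ⟨⟨i, hi.2⟩, hi.1, rfl⟩

theorem count_add {n m : ℕ} (h : m ≤ n) (ρ : Fin n → Pt) (c : Pt) :
    count (fun j : Fin (n - m) => ρ ⟨m + j.1, by have := j.isLt; omega⟩) c =
      (Finset.univ.filter fun i : Fin n => ρ i = c ∧ ¬ (i : ℕ) < m).card := by
  refine Finset.card_nbij (fun j : Fin (n - m) => ⟨m + j.1, by have := j.isLt; omega⟩) ?_ ?_ ?_
  · intro j hj
    simpa using hj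
  · intro j _ j' _ hjj
    simpa [Fin.ext_iff] using hjj
  · intro i hi
    simp only [Finset.coe_filter, Finset.mem_univ, true_and, Set.mem_ofPred_eq, not_lt] at hi
    have hv : m + (i.1 - m) = i.1 := by omega
    refine ⟨⟨i.1 - m, by have := i.isLt; omega⟩, ?_, ?_⟩
    · simp [hv, hi.1]
    · simp [hv]

/-- A word over `T` has type `λ` iff its truncation has type `λ'` and the last letters
have the right weights. -/
theorem count_triple_eq_iff {n : ℕ} (lam : Lambda Tt n) (a b τ : Fin n → ZMod 2) :
    count (fun i => (a i, b i, τ i)) = lam.1 ↔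
      lamPrime lam = count (fun i => (a i, b i)) ∧
        ∀ c : Pt, (Finset.univ.filter fun i => (a i, b i) = c ∧ τ i = 1).card =
          lam.1 (c.1, c.2, 1) := by
  have h1 (c : Pt) (z : ZMod 2) : count (fun i => (a i, b i, τ i)) (c.1, c.2, z) =
      (Finset.univ.filter fun i => (a i, b i) = c ∧ τ i = z).card := by
    simp [count, Prod.ext_iff, and_assoc]
  have h2 (c : Pt) : count (fun i => (a i, b i)) c =
      (Finset.univ.filter fun i => (a i, b i) = c ∧ τ i = 0).card +
      (Finset.univ.filter fun i => (a i, b i) = c ∧ τ i = 1).card := by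
    have hz (z : ZMod 2) : ¬ z = 0 ↔ z = 1 := by decide +revert
    rw [count, ← Finset.card_filter_add_card_filter_not (fun i => τ i = 0)]
    simp_rw [hz, Finset.filter_filter]
  constructor
  · intro h
    have h3 (c : Pt) (z : ZMod 2) := (h1 c z).symm.trans (congrFun h _)
    refine ⟨funext fun c => ?_, fun c => h3 c 1⟩
    rw [h2, h3, h3]
    rfl
  · rintro ⟨h, h'⟩
    funext t
    obtain ⟨x, y, z⟩ := t
    rw [h1 (x, y) z]
    have h4 := congrFun h (x, y)
    rw [h2, h', lamPrime] at h4
    fin_cases z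
    · exact (Nat.add_right_cancel h4).symm
    · exact h' (x, y)

/-- The sum over words `ρ` over `T` is a sum over the last letters, the first two being forced. -/
theorem sum_triple_eq_sum {n : ℕ} (lam : Lambda Tt n) (a b : Fin n → ZMod 2)
    (ε : Fin n → ℂ) :
    (∑ ρ : Fin n → Tt, if count ρ = lam.1 then
        ∏ i : Fin n, (if (ρ i).1 = a i ∧ (ρ i).2.1 = b i then ε i ^ (ρ i).2.2.val else 0)
        else 0) =
      ∑ τ : Fin n → ZMod 2, if count (fun i => (a i, b i, τ i)) = lam.1 then
        ∏ i, ε i ^ (τ i).val else 0 := by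
  symm
  refine Fintype.sum_of_injective (fun τ i => (a i, b i, τ i)) ?_ _ _ ?_ ?_
  · intro τ τ' h
    funext i
    simpa using congrFun h i
  · intro ρ hρ
    have : ∃ i, ¬ ((ρ i).1 = a i ∧ (ρ i).2.1 = b i) := by
      by_contra! hc
      exact hρ ⟨fun i => (ρ i).2.2, funext fun i => by simp [← (hc i).1, ← (hc i).2]⟩
    obtain ⟨i, hi⟩ := this
    split_ifs
    · exact Finset.prod_eq_zero (Finset.mem_univ i) (if_neg hi)
    · rfl
  · intro τ
    simp

/-- `(U_0^{⊗m} ⊗ U_1^{⊗(n−m)})^* · B_λ · (U_0^{⊗m} ⊗ U_1^{⊗(n−m)})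
 = ∑_{α ∈ Λ_P^m, β ∈ Λ_P^{n−m}} ϑ_{λ,α,β} · (M_α ⊗ M_β)`. -/
theorem conj_BmatN_eq (n : ℕ) (hn : 0 < n) (lam : Lambda Tt n) (m : ℕ) (h : m ≤ n) :
    (UU n m)ᴴ * BmatN lam * UU n m =
      ∑ α : Lambda Pt m, ∑ β : Lambda Pt (n - m),
        ((theta lam α β : ℤ) : ℂ) • kron h (Mmat α) (Mmat β) := by
  ext a b
  set c : Fin n → Pt := fun i => (a i, b i) with hc
  rw [conj_BmatN_apply, sum_triple_eq_sum lam a b fun i => if ¬ (i : ℕ) < m then -1 else 1]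
  have hcount (x : Pt) : count c x =
      count (fun i => c (Fin.castLE h i)) x +
        count (fun j : Fin (n - m) => c ⟨m + j.1, by have := j.isLt; omega⟩) x := by
    rw [count_castLE, count_add h, count,
      ← Finset.card_filter_add_card_filter_not (fun i : Fin n => (i : ℕ) < m)]
    simp_rw [Finset.filter_filter]
  simp only [Matrix.sum_apply, Matrix.smul_apply, kron, Mmat_apply, smul_eq_mul]
  rw [sum_sum_mul_ite_count (fun i => c (Fin.castLE h i))
    (fun j : Fin (n - m) => c ⟨m + j.1, by have := j.isLt; omega⟩) fun α β => (theta lam α β : ℂ)]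
  simp_rw [count_triple_eq_iff, theta, ← hcount, count_add h, ← hc]
  by_cases hl : lamPrime lam = count c
  · have key := congrArg (Int.cast : ℤ → ℂ) (sum_sign_eq_prod_Kraw c (fun i => ¬ (i : ℕ) < m)
      fun x => lam.1 (x.1, x.2, 1))
    push_cast at key
    rw [if_pos hl]
    push_cast
    simp only [hl, true_and]
    convert key
    simp only [count]
  · rw [if_neg hl, Int.cast_zero]
    exact Finset.sum_eq_zero fun τ _ => if_neg fun h => hl h.1
end
end
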